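/- arXiv:math-ph/0112025 — 7 statements merged into one kernel-verified Lean document; each statement's English description precedes it below -/
import Mathlib

section
/- Fix N ≥ 2, m ≥ 1, set n = Nm, and let ℏ ≠ 0. Let {1,…,n} = K₀ ⊔ K₁ ⊔ ⋯ ⊔ K_{N−1} be a partition into sets each of cardinality m, and let β₁,…,β_n be indeterminates. For a ∈ K_r define μ^{(a)}(α) := [1/(α−β_a)] · ∏_{k∈K_r, k≠a}(α−β_k−ℏ)/(β_a−β_k−ℏ) · ∏_{j∈K_p, p>r}(α−β_j−ℏ)/(α−β_j). Set L^{(0)}(α) := ∏_{k∈K₀}(α−β_k−Nℏ) and define the operator D by (Df)(α) := f(α) − f(α+Nℏ)·∏_{j=1}^{n}(α−β_j−ℏ)/(α−β_j). Then the following identity of rational functions in α, β₁,…,β_n holds: (DL^{(0)})(α) = ℏ · Σ_{r=1}^{N−1} Σ_{k∈K_r} ∏_{j∈K₀}(β_k−β_j−rℏ) · ∏_{j∈K_r, j≠k}(β_k−β_j−ℏ)/(β_k−β_j) · μ^{(k)}(α). -/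
open Finset

noncomputable section

/-- The rational function `μ_J^{(a)}(α)` of Section 6.1.  The partition
`{1,…,n} = K₀ ⊔ ⋯ ⊔ K_{N−1}` is encoded by the classifying map `cl`, so that
`K_r = {j | cl j = r}`. -/
def μfun {n : ℕ} (ℏ : ℂ) (cl : Fin n → ℕ) (β : Fin n → ℂ) (a : Fin n) (x : ℂ) : ℂ :=
  (x - β a)⁻¹ *
    (∏ k ∈ (Finset.univ.filter fun k => cl k = cl a).erase a,
      (x - β k - ℏ) / (β a - β k - ℏ)) *
    ∏ j ∈ Finset.univ.filter fun j => cl a < cl j, (x - β j - ℏ) / (x - β j)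

open Polynomial in
/-- Lagrange interpolation of a monic polynomial of degree equal to the number of nodes. -/
theorem eval_eq_prod_add_sum_of_monic {F ι : Type*} [Field F] [DecidableEq ι] {s : Finset ι}
    {b : ι → F} (hb : Set.InjOn b s) {p : F[X]} (hp : p.Monic) (hdeg : p.natDegree = s.card)
    (x : F) :
    p.eval x = ∏ j ∈ s, (x - b j) +
      ∑ k ∈ s, p.eval (b k) * ∏ j ∈ s.erase k, (x - b j) / (b k - b j) := by
  have hlt : (p - Lagrange.nodal s b).degree < s.card := by
    have hpd : p.degree = s.card := by rw [degree_eq_natDegree hp.ne_zero, hdeg]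
    rw [← hpd]
    refine degree_sub_lt_left ?_ hp.ne_zero ?_
    · rw [Lagrange.degree_nodal, hpd]
    · rw [hp.leadingCoeff, Lagrange.nodal_monic.leadingCoeff]
  have h := congrArg (eval x) (Lagrange.eq_interpolate hb hlt)
  rw [eval_sub, Lagrange.eval_nodal, sub_eq_iff_eq_add'] at h
  rw [h, Lagrange.interpolate_apply, eval_finsetSum]
  refine congrArg _ (Finset.sum_congr rfl fun k hk => ?_)
  rw [eval_mul, eval_C, eval_sub, Lagrange.eval_nodal_at_node hk, sub_zero, Lagrange.basis,
    eval_prod]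
  refine congrArg _ (Finset.prod_congr rfl fun j _ => ?_)
  simp [Lagrange.basisDivisor, div_eq_inv_mul]

open Polynomial in
/-- Partial fraction expansion of `p(x - h) - p(x) q(x - h) / q(x)` with `q = ∏ (X - b j)`. -/
theorem eval_sub_sub_mul_prod_div {F ι : Type*} [Field F] [DecidableEq ι] {s : Finset ι}
    {b : ι → F} (hb : Set.InjOn b s) {p : F[X]} (hp : p.Monic) (hdeg : p.natDegree = s.card)
    (x h : F) (hx : ∀ j ∈ s, x - b j ≠ 0) :
    p.eval (x - h) - p.eval x * ∏ j ∈ s, (x - b j - h) / (x - b j) =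
      h * ∑ k ∈ s, p.eval (b k) *
        ((x - b k)⁻¹ * ∏ j ∈ s.erase k, (x - b j - h) / (b k - b j)) := by
  have hq : ∏ j ∈ s, (x - b j) ≠ 0 := Finset.prod_ne_zero_iff.2 hx
  rw [eval_eq_prod_add_sum_of_monic hb hp hdeg (x - h), eval_eq_prod_add_sum_of_monic hb hp hdeg x,
    add_mul, Finset.prod_div_distrib, mul_div_cancel₀ _ hq]
  simp only [sub_right_comm x h]
  rw [add_sub_add_left_eq_sub, Finset.sum_mul, ← Finset.sum_sub_distrib, Finset.mul_sum]
  refine Finset.sum_congr rfl fun k hk => ?_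
  have hk0 := hx k hk
  have hE : ∏ j ∈ s.erase k, (x - b j) ≠ 0 :=
    Finset.prod_ne_zero_iff.2 fun j hj => hx j (Finset.mem_of_mem_erase hj)
  rw [← Finset.mul_prod_erase s _ hk, ← Finset.mul_prod_erase s (fun j => x - b j) hk]
  simp only [Finset.prod_div_distrib, div_eq_mul_inv _ (∏ j ∈ s.erase k, (b k - b j))]
  field_simp
  ring

/-- Proposition `putD`.  Here `L⁰(α) = ∏_{k∈K₀}(α−β_k−Nℏ)` and
`(Df)(α) = f(α) − f(α+Nℏ)·∏_j (α−β_j−ℏ)/(α−β_j)`; the left-hand side below is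
`(DL⁰)(α)` written out.  The identity is stated for all complex values for which
every denominator occurring is nonzero. -/
theorem statement6 (N m : ℕ) (hN : 2 ≤ N) (hm : 1 ≤ m) (ℏ : ℂ) (hℏ : ℏ ≠ 0)
    (cl : Fin (N * m) → ℕ) (hcl : ∀ j, cl j < N)
    (hfib : ∀ r < N, (Finset.univ.filter fun j => cl j = r).card = m)
    (β : Fin (N * m) → ℂ) (α : ℂ)
    (hαβ : ∀ j, α - β j ≠ 0)
    (hββ : ∀ j k, cl j = cl k → j ≠ k → β j - β k ≠ 0 ∧ β j - β k - ℏ ≠ 0) :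
    (∏ k ∈ Finset.univ.filter fun k => cl k = 0, (α - β k - (N : ℂ) * ℏ)) -
        (∏ k ∈ Finset.univ.filter fun k => cl k = 0,
            (α + (N : ℂ) * ℏ - β k - (N : ℂ) * ℏ)) *
          ∏ j, (α - β j - ℏ) / (α - β j) =
      ℏ * ∑ r ∈ Icc 1 (N - 1), ∑ k ∈ Finset.univ.filter fun k => cl k = r,
        (∏ j ∈ Finset.univ.filter fun j => cl j = 0, (β k - β j - (r : ℂ) * ℏ)) *
          (∏ j ∈ (Finset.univ.filter fun j => cl j = r).erase k,
            (β k - β j - ℏ) / (β k - β j)) *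
          μfun ℏ cl β k α := by
  set K : ℕ → Finset (Fin (N * m)) := fun r => Finset.univ.filter fun j => cl j = r with hK
  let P : ℕ → ℂ → ℂ := fun r x => ∏ j ∈ K 0, (x - β j - (r : ℂ) * ℏ)
  let G : ℕ → ℂ := fun r =>
    P r α * ∏ j ∈ Finset.univ.filter fun j => r ≤ cl j, (α - β j - ℏ) / (α - β j)
  have hstep : ∀ r < N, G (r + 1) - G r = ℏ * ∑ k ∈ K r, P r (β k) *
      (∏ j ∈ (K r).erase k, (β k - β j - ℏ) / (β k - β j)) * μfun ℏ cl β k α := by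
    intro r hr
    let p : Polynomial ℂ := Lagrange.nodal (K 0) fun j => β j + (r : ℂ) * ℏ
    have hpeval : ∀ x, p.eval x = P r x := fun x => by
      simp only [p, P, Lagrange.eval_nodal, sub_sub]
    have hinj : Set.InjOn β (K r) := by
      intro j hj k hk hjk
      by_contra hne
      refine (hββ j k ?_ hne).1 (sub_eq_zero.2 hjk)
      simp only [hK, Finset.coe_filter, Finset.mem_univ, true_and, Set.mem_ofPred_eq] at hj hk
      rw [hj, hk]
    have key := eval_sub_sub_mul_prod_div hinj (p := p) Lagrange.nodal_monic
      (by rw [Lagrange.natDegree_nodal, hfib 0 (by omega), hfib r hr]) α ℏ (fun j _ => hαβ j)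
    simp only [hpeval] at key
    have hshift : P r (α - ℏ) = P (r + 1) α :=
      Finset.prod_congr rfl fun j _ => by push_cast; ring
    have hsplit : (∏ j ∈ Finset.univ.filter fun j => r ≤ cl j, (α - β j - ℏ) / (α - β j)) =
        (∏ j ∈ K r, (α - β j - ℏ) / (α - β j)) *
          ∏ j ∈ Finset.univ.filter fun j => r < cl j, (α - β j - ℏ) / (α - β j) := by
      rw [← Finset.prod_union]
      · refine Finset.prod_congr ?_ fun _ _ => rfl
        ext j
        simp [hK, le_iff_eq_or_lt, eq_comm]
      · simp only [hK, Finset.disjoint_filter]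
        omega
    have hG : G (r + 1) - G r = (P r (α - ℏ) - P r α * ∏ j ∈ K r, (α - β j - ℏ) / (α - β j)) *
        ∏ j ∈ Finset.univ.filter fun j => r < cl j, (α - β j - ℏ) / (α - β j) := by
      simp only [G, hsplit, hshift, Nat.succ_le_iff]
      ring
    rw [hG, key, mul_assoc, Finset.sum_mul]
    refine congrArg _ (Finset.sum_congr rfl fun k hk => ?_)
    have hk' : cl k = r := by simpa [hK] using hk
    have hcancel : (∏ j ∈ (K r).erase k, (α - β j - ℏ) / (β k - β j)) =
        (∏ j ∈ (K r).erase k, (β k - β j - ℏ) / (β k - β j)) *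
          ∏ j ∈ (K r).erase k, (α - β j - ℏ) / (β k - β j - ℏ) := by
      rw [← Finset.prod_mul_distrib]
      refine Finset.prod_congr rfl fun j hj => ?_
      have hj' : j ≠ k ∧ cl j = r := by simpa [hK] using hj
      have hne := hββ k j (hk'.trans hj'.2.symm) hj'.1.symm
      rw [mul_comm, div_mul_div_cancel₀ hne.2]
    rw [hcancel]
    simp only [μfun, hk', hK]
    ring
  have htel : ∑ r ∈ Icc 1 (N - 1), (G (r + 1) - G r) = G N - G 1 := by
    rw [← Finset.sum_Ico_sub G (by omega : 1 ≤ N)]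
    refine Finset.sum_congr ?_ fun _ _ => rfl
    ext r
    simp only [Finset.mem_Icc, Finset.mem_Ico]
    omega
  have hGN : G N = P N α := by
    have : (Finset.univ.filter fun j => N ≤ cl j) = ∅ := by
      simpa [Finset.filter_eq_empty_iff] using hcl
    simp only [G, this, Finset.prod_empty, mul_one]
  have hG1 : G 1 = P 0 α * ∏ j, (α - β j - ℏ) / (α - β j) := by
    have hcompl : (Finset.univ.filter fun j => ¬ cl j = 0) =
        Finset.univ.filter fun j => 1 ≤ cl j := by
      simp only [Nat.one_le_iff_ne_zero, ne_eq]
    rw [← Finset.prod_filter_mul_prod_filter_not Finset.univ (fun j => cl j = 0), hcompl,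
      ← mul_assoc]
    simp only [G, P]
    rw [← Finset.prod_mul_distrib]
    refine congrArg (· * _) (Finset.prod_congr rfl fun j _ => ?_)
    have := hαβ j
    simp only [Nat.cast_zero, zero_mul, sub_zero, Nat.cast_one, one_mul]
    rw [mul_div_cancel₀ _ this]
  have hP0 : ∏ k ∈ K 0, (α + (N : ℂ) * ℏ - β k - (N : ℂ) * ℏ) = P 0 α :=
    Finset.prod_congr rfl fun j _ => by push_cast; ring
  calc _ = G N - G 1 := by rw [hGN, hG1, ← hP0]
    _ = _ := by
      rw [← htel, Finset.mul_sum]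
      refine Finset.sum_congr rfl fun r hr => hstep r ?_
      have := Finset.mem_Icc.1 hr
      omega

end
end

section
/- Fix N ≥ 2, n ≥ 1, a nonzero complex number ℏ, and integers n ≥ ν₁ ≥ ⋯ ≥ ν_{N−1} ≥ 0. Let F be a V_N^{⊗n}-valued function of (x₁,…,x_n), defined for all tuples of complex numbers with x_i − x_j ∉ {0, −ℏ, ℏ} for i ≠ j, whose component functions F_ε (in the expansion F = Σ_ε F_ε · v_{ε₁}⊗⋯⊗v_{ε_n} over ε ∈ Z_{ν₁,…,ν_{N−1}}) are the only nonzero components, and which satisfies for each j the exchange relation F(…,x_{j+1},x_j,…) = P_{j,j+1}R_{j,j+1}(x_j−x_{j+1}) F(…,x_j,x_{j+1},…) on its domain. If F_{ε⁰} is identically zero for some ε⁰ ∈ Z_{ν₁,…,ν_{N−1}}, then F is identically zero. -/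
open Finset
open scoped Classical

noncomputable section

/-- `ε ∈ Z_{ν₁,…,ν_{N−1}}`: the `n`-tuple `ε` with entries in `{0,…,N−1}` satisfies
`#{r : ε_r ≥ j} = ν j` for `j = 1,…,N−1`. -/
def IsZν (N n : ℕ) (ν : ℕ → ℕ) (ε : Fin n → Fin N) : Prop :=
  ∀ j, 1 ≤ j → j ≤ N - 1 →
    (Finset.univ.filter fun r => j ≤ (ε r : ℕ)).card = ν j

/-- The points of the domain: tuples `x` with `x_i − x_j ∉ {0, −ℏ, ℏ}` for `i ≠ j`. -/
def DomOk {n : ℕ} (ℏ : ℂ) (x : Fin n → ℂ) : Prop :=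
  ∀ i j : Fin n, i ≠ j → x i - x j ≠ 0 ∧ x i - x j ≠ ℏ ∧ x i - x j ≠ -ℏ

theorem DomOk.comp_perm {n : ℕ} {ℏ : ℂ} {x : Fin n → ℂ} (hx : DomOk ℏ x)
    (σ : Equiv.Perm (Fin n)) : DomOk ℏ (x ∘ σ) :=
  fun i j hij => hx (σ i) (σ j) (σ.injective.ne hij)

/-- A set of functions on `Fin n` closed under swapping neighbouring arguments is closed under
all permutations of the arguments. -/
theorem comp_perm_of_comp_adjacent_swap {n : ℕ} {α : Type*} {S : (Fin n → α) → Prop}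
    (hS : ∀ p q : Fin n, (q : ℕ) = p + 1 → ∀ κ, S κ → S (κ ∘ Equiv.swap p q))
    (σ : Equiv.Perm (Fin n)) {κ : Fin n → α} (hκ : S κ) : S (κ ∘ σ) := by
  cases n with
  | zero => rwa [Subsingleton.elim σ 1]
  | succ m =>
    have hσ : σ ∈ Submonoid.closure
        (Set.range fun i : Fin m => Equiv.swap i.castSucc i.succ) := by
      rw [Equiv.Perm.mclosure_swap_castSucc_succ]
      trivial
    induction hσ using Submonoid.closure_induction_right with
    | one => exact hκ
    | mul_right τ _ y hy ih =>
      obtain ⟨i, rfl⟩ := hy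
      exact hS _ _ (by simp) _ ih

theorem IsZν.card_filter_le_eq {N n : ℕ} {ν : ℕ → ℕ} {ε κ : Fin n → Fin N}
    (hε : IsZν N n ν ε) (hκ : IsZν N n ν κ) (j : ℕ) :
    (univ.filter fun r => j ≤ (ε r : ℕ)).card = (univ.filter fun r => j ≤ (κ r : ℕ)).card := by
  rcases Nat.eq_zero_or_pos j with rfl | hj
  · simp
  rcases le_or_gt j (N - 1) with hjN | hjN
  · rw [hε j hj hjN, hκ j hj hjN]
  · have h (η : Fin n → Fin N) : (univ.filter fun r => j ≤ (η r : ℕ)) = ∅ :=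
      filter_false_of_mem fun r _ => by have := (η r).isLt; omega
    rw [h ε, h κ]

theorem card_filter_eq_add_card_filter_succ_le {N n : ℕ} (ε : Fin n → Fin N) (a : Fin N) :
    (univ.filter fun r => ε r = a).card + (univ.filter fun r => (a : ℕ) + 1 ≤ (ε r : ℕ)).card =
      (univ.filter fun r => (a : ℕ) ≤ (ε r : ℕ)).card := by
  rw [← card_union_of_disjoint]
  · congr 1
    ext r
    simp only [mem_union, mem_filter, mem_univ, true_and, Fin.ext_iff]
    omega
  · refine disjoint_filter.2 fun r _ h => ?_
    rw [h]
    omega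

/-- Any two elements of `Z_{ν₁,…,ν_{N−1}}` differ by a permutation of their entries. -/
theorem IsZν.exists_perm {N n : ℕ} {ν : ℕ → ℕ} {ε κ : Fin n → Fin N}
    (hε : IsZν N n ν ε) (hκ : IsZν N n ν κ) : ∃ σ : Equiv.Perm (Fin n), κ = ε ∘ σ := by
  have hcard (a : Fin N) :
      (univ.filter fun r => κ r = a).card = (univ.filter fun r => ε r = a).card := by
    have h₁ := card_filter_eq_add_card_filter_succ_le ε a
    have h₂ := card_filter_eq_add_card_filter_succ_le κ a
    have h₃ := hε.card_filter_le_eq hκ a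
    have h₄ := hε.card_filter_le_eq hκ (a + 1)
    omega
  have e (a : Fin N) : {r // κ r = a} ≃ {r // ε r = a} :=
    Fintype.equivOfCardEq (by simpa only [Fintype.card_subtype] using hcard a)
  exact ⟨Equiv.ofFiberEquiv e, funext fun r => (Equiv.ofFiberEquiv_map e r).symm⟩

/-- Lemma `tec`.  The `V_N^{⊗n}`-valued function `F` is encoded by its
coordinate functions `F x κ` on multi-indices `κ : Fin n → Fin N`; its only nonzero
components are those with `κ ∈ Z_{ν₁,…,ν_{N−1}}`, and it satisfies the exchange
relation `F(…,x_{j+1},x_j,…) = P R(x_j−x_{j+1}) F(…,x_j,x_{j+1},…)`, i.e. on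
coordinates `F(x∘s)(κ) = ((x_p−x_q)·F(x)(κ∘s) + ℏ·F(x)(κ))/(x_p−x_q+ℏ)` with
`s = swap p q`.  If the component `F_{ε⁰}` vanishes identically on the domain for
some `ε⁰ ∈ Z`, then `F` vanishes identically on the domain. -/
theorem statement9 (N n : ℕ) (hN : 2 ≤ N) (hn : 1 ≤ n) (ℏ : ℂ) (hℏ : ℏ ≠ 0)
    (ν : ℕ → ℕ) (hν1 : ν 1 ≤ n) (hmono : ∀ j, 1 ≤ j → j + 1 ≤ N - 1 → ν (j + 1) ≤ ν j)
    (F : (Fin n → ℂ) → (Fin n → Fin N) → ℂ)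
    (hsupp : ∀ x κ, ¬ IsZν N n ν κ → F x κ = 0)
    (hexch : ∀ p q : Fin n, (q : ℕ) = (p : ℕ) + 1 →
      ∀ x : Fin n → ℂ, DomOk ℏ x → ∀ κ : Fin n → Fin N,
        F (x ∘ Equiv.swap p q) κ =
          ((x p - x q) * F x (κ ∘ Equiv.swap p q) + ℏ * F x κ) / (x p - x q + ℏ))
    (ε0 : Fin n → Fin N) (hε0 : IsZν N n ν ε0)
    (hzero : ∀ x : Fin n → ℂ, DomOk ℏ x → F x ε0 = 0) :
    ∀ x : Fin n → ℂ, DomOk ℏ x → ∀ κ : Fin n → Fin N, F x κ = 0 := by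
  intro x hx κ
  by_cases hκ : IsZν N n ν κ
  · obtain ⟨σ, rfl⟩ := hε0.exists_perm hκ
    refine comp_perm_of_comp_adjacent_swap (S := fun κ => ∀ x, DomOk ℏ x → F x κ = 0)
      (fun p q hpq κ hκ x hx => ?_) σ hzero x hx
    have hne : p ≠ q := by
      rintro rfl
      omega
    obtain ⟨h₀, -, h₁⟩ := hx p q hne
    have h := hexch p q hpq x hx κ
    rw [hκ _ (hx.comp_perm _), hκ x hx, mul_zero, add_zero, eq_comm, div_eq_zero_iff,
      mul_eq_zero] at h
    exact (h.resolve_right fun h => h₁ (eq_neg_of_add_eq_zero_left h)).resolve_left h₀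
  · exact hsupp x κ hκ

end
end

section
/- Let N ≥ 3 be an integer, ω := e^{−2πi/N}, and for 0 ≤ j ≤ k let [k choose j]_{ω^{−1}} denote the q-binomial coefficient with q = ω^{−1}, i.e. [k choose j]_{ω^{−1}} = ∏_{i=1}^{j} (1−ω^{−(k−i+1)})/(1−ω^{−i}). For 0 ≤ k ≤ N−2 and nonzero complex numbers A₁,…,A_N, B define P_k(A₁,…,A_N | B) := Σ_{j=0}^{k} ω^{−j(j−1)/2} [k choose j]_{ω^{−1}} B^{−j} · ∏_{a=1}^{N−j−1} A_a^{a} · ∏_{a=N−j}^{N−1} A_a^{a+1} · A_N^{N+1}. Then for every k with 0 ≤ k ≤ N−3: Skew( P_k(A₁,…,A_N | ωB) ) = Skew( ∏_{a=1}^{N−1}(1−B^{−1}A_a) · P_{k+1}(A₁,…,A_N | B) ), where Skew denotes the skew-symmetrization Σ_{σ∈S_N} sgn(σ)·f(A_{σ(1)},…,A_{σ(N)}) with respect to A₁,…,A_N. -/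
open Finset

noncomputable section

/-- The `q`-binomial coefficient `[k choose j]` with `q = ω⁻¹`,
`[k choose j] = ∏_{i=1}^{j} (1−ω^{−(k−i+1)})/(1−ω^{−i})`. -/
def qbin (ω : ℂ) (k j : ℕ) : ℂ :=
  ∏ i ∈ Finset.Icc 1 j, (1 - ω ^ (-((k : ℤ) - (i : ℤ) + 1))) / (1 - ω ^ (-(i : ℤ)))

/-- The function `P_k(A₁,…,A_N | B)` of Section 7.3 (statement 14).  The tuple
`A : Fin N → ℂ` is 0-indexed: `A ⟨a-1⟩` plays the role of `A_a` for `1 ≤ a ≤ N`;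
the exponent of `A_a` is `a` for `1 ≤ a ≤ N−j−1`, `a+1` for `N−j ≤ a ≤ N−1`, and
`N+1` for `a = N`. -/
def Pfun (N : ℕ) (ω : ℂ) (k : ℕ) (A : Fin N → ℂ) (B : ℂ) : ℂ :=
  ∑ j ∈ Finset.range (k + 1),
    ω ^ (-((j * (j - 1) / 2 : ℕ) : ℤ)) * qbin ω k j * B ^ (-(j : ℤ)) *
      ∏ a : Fin N,
        A a ^ (if (a : ℕ) < N - 1 - j then (a : ℕ) + 1
          else if (a : ℕ) < N - 1 then (a : ℕ) + 2 else N + 1)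

/-- Skew-symmetrization with respect to the variables `A₁,…,A_N`. -/
def skewA {N : ℕ} (f : (Fin N → ℂ) → ℂ) (A : Fin N → ℂ) : ℂ :=
  ∑ σ : Equiv.Perm (Fin N), ((Equiv.Perm.sign σ : ℤ) : ℂ) * f (A ∘ σ)

theorem qbin_succ (ω : ℂ) (n m : ℕ) :
    qbin ω n (m + 1) =
      qbin ω n m * ((1 - ω ^ (-((n : ℤ) - m))) / (1 - ω ^ (-((m : ℤ) + 1)))) := by
  rw [qbin, Finset.prod_Icc_succ_top (by omega), ← qbin]
  push_cast
  congr 5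
  ring

theorem qbin_succ_succ (ω : ℂ) (n m : ℕ) :
    qbin ω (n + 1) (m + 1) =
      qbin ω n m * ((1 - ω ^ (-((n : ℤ) + 1))) / (1 - ω ^ (-((m : ℤ) + 1)))) := by
  induction m with
  | zero => simp [qbin]
  | succ m ih =>
    rw [qbin_succ, ih, qbin_succ ω n m]
    have h : ((n + 1 : ℕ) : ℤ) - ((m + 1 : ℕ) : ℤ) = n - m := by push_cast; ring
    rw [h]
    ring

theorem qbin_eq_zero (ω : ℂ) {k j : ℕ} (h : k < j) : qbin ω k j = 0 := by
  refine Finset.prod_eq_zero (i := k + 1) (by simp; omega) ?_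
  simp

/-- The `q`-Pascal rule for `q = ω⁻¹`. -/
theorem qbin_pascal {ω : ℂ} (hω : ω ≠ 0) (n m : ℕ) (hm : ω ^ (-((m : ℤ) + 1)) ≠ 1) :
    qbin ω (n + 1) (m + 1) = qbin ω n m + ω ^ (-((m : ℤ) + 1)) * qbin ω n (m + 1) := by
  have hd : 1 - ω ^ (-((m : ℤ) + 1)) ≠ 0 := sub_ne_zero.2 hm.symm
  have hmul : ω ^ (-((m : ℤ) + 1)) * ω ^ (-((n : ℤ) - m)) = ω ^ (-((n : ℤ) + 1)) := by
    rw [← zpow_add₀ hω]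
    congr 1
    ring
  rw [qbin_succ_succ, qbin_succ, ← hmul]
  field_simp
  ring

theorem sum_alternating_qbin {ω : ℂ} (hω : ω ≠ 0) (n m : ℕ)
    (hm : ∀ i : ℕ, i < m → ω ^ (-((i : ℤ) + 1)) ≠ 1) :
    ∑ j ∈ Finset.range (m + 1),
        (-1) ^ j * (ω ^ (-((j * (j - 1) / 2 : ℕ) : ℤ)) * qbin ω (n + 1) j) =
      (-1) ^ m * (ω ^ (-((m * (m - 1) / 2 : ℕ) : ℤ)) * ω ^ (-(m : ℤ)) * qbin ω n m) := by
  induction m with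
  | zero => simp [qbin]
  | succ m ih =>
    rw [Finset.sum_range_succ, ih fun i hi => hm i (by omega),
      qbin_pascal hω n m (hm m (by omega)), Nat.triangle_succ]
    have h : ω ^ (-((m * (m - 1) / 2 + m : ℕ) : ℤ)) =
        ω ^ (-((m * (m - 1) / 2 : ℕ) : ℤ)) * ω ^ (-(m : ℤ)) := by
      rw [← zpow_add₀ hω]
      congr 1
      push_cast
      ring
    rw [h]
    push_cast
    ring

theorem skewA_sum {N : ℕ} {ι : Type*} (s : Finset ι) (c : ι → ℂ)
    (f : ι → (Fin N → ℂ) → ℂ) (A : Fin N → ℂ) :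
    skewA (fun A' => ∑ i ∈ s, c i * f i A') A = ∑ i ∈ s, c i * skewA (f i) A := by
  simp only [skewA, Finset.mul_sum]
  rw [Finset.sum_comm]
  refine Finset.sum_congr rfl fun i _ => Finset.sum_congr rfl fun σ _ => ?_
  ring

theorem skewA_monomial_eq_det {N : ℕ} (e : Fin N → ℕ) (A : Fin N → ℂ) :
    skewA (fun A' => ∏ a, A' a ^ e a) A =
      (Matrix.of fun i a => A i ^ e a).det := by
  simp [skewA, Matrix.det_apply, Units.smul_def]

theorem skewA_monomial_eq_zero {N : ℕ} {e : Fin N → ℕ} {a b : Fin N} (hab : a ≠ b)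
    (h : e a = e b) (A : Fin N → ℂ) : skewA (fun A' => ∏ a, A' a ^ e a) A = 0 := by
  rw [skewA_monomial_eq_det]
  exact Matrix.det_zero_of_column_eq hab fun i => by simp [h]

/-- The exponents `1, …, N + 1` with `N - j` left out, in increasing order. -/
def gapExp (N j : ℕ) (a : Fin N) : ℕ :=
  if (a : ℕ) < N - 1 - j then (a : ℕ) + 1
    else if (a : ℕ) < N - 1 then (a : ℕ) + 2 else N + 1

theorem gapExp_add_indicator {N j m : ℕ} (hjm : j ≤ m) (a : Fin N) :
    gapExp N j a + (if N - 1 - m ≤ (a : ℕ) ∧ (a : ℕ) < N - 1 - j then 1 else 0) =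
      gapExp N m a := by
  unfold gapExp
  split_ifs <;> omega

/-- A set of columns whose exponents can be raised by one without creating a repeated exponent
is a final segment of the columns before the gap. -/
theorem exists_eq_segment {N j : ℕ} (hj : j < N) {S : Finset (Fin N)}
    (hS : ∀ a ∈ S, (a : ℕ) < N - 1)
    (hinj : Function.Injective fun a => gapExp N j a + if a ∈ S then 1 else 0) :
    ∃ m ∈ Finset.Ico j N,
      S = Finset.univ.filter fun a : Fin N => N - 1 - m ≤ (a : ℕ) ∧ (a : ℕ) < N - 1 - j := by
  have hstep : ∀ (a : Fin N) (b : Fin N), a ∈ S → (b : ℕ) = a + 1 →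
      (a : ℕ) + 1 ≠ N - 1 - j → b ∈ S := by
    intro a b ha hb hne
    by_contra hbS
    have hab : a = b := hinj (by
      have := hS a ha
      have := b.isLt
      simp only [ha, hbS, if_true, if_false, gapExp]
      split_ifs <;> omega)
    rw [hab] at hb
    omega
  have hup : ∀ (d : ℕ) (a b : Fin N), a ∈ S → (b : ℕ) = a + d →
      ((a : ℕ) < N - 1 - j → (b : ℕ) < N - 1 - j) → b ∈ S := by
    intro d
    induction d with
    | zero =>
      intro a b ha hb _
      rwa [show b = a from Fin.ext (by omega)]
    | succ d ih =>
      intro a b ha hb hlt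
      have := b.isLt
      exact hstep ⟨a + d, by omega⟩ b (ih a _ ha rfl fun h => by have := hlt h; simp; omega)
        (by simp; omega) (by simp; omega)
  have hlow : ∀ a ∈ S, (a : ℕ) < N - 1 - j := by
    intro a ha
    by_contra hlt
    have hlast : (⟨N - 1, by omega⟩ : Fin N) ∈ S :=
      hup (N - 1 - a) a _ ha (by simp; omega) fun h => absurd h hlt
    simpa using hS _ hlast
  rcases S.eq_empty_or_nonempty with rfl | hne
  · refine ⟨j, by simp [hj], ?_⟩
    ext a
    simp
  · have hmin := S.min'_mem hne
    have hminlt := hlow _ hmin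
    refine ⟨N - 1 - (S.min' hne : ℕ), by simp; omega, ?_⟩
    ext a
    simp only [Finset.mem_filter, Finset.mem_univ, true_and]
    constructor
    · intro ha
      have h1 : (S.min' hne : ℕ) ≤ a := S.min'_le a ha
      exact ⟨by omega, hlow a ha⟩
    · rintro ⟨h1, h2⟩
      exact hup (a - S.min' hne) _ a hmin (by omega) fun _ => h2

theorem skewA_prod_one_sub_mul_monomial {N j : ℕ} (hj : j < N) (c : ℂ) (A : Fin N → ℂ) :
    skewA (fun A' =>
        (∏ a ∈ Finset.univ.filter fun a : Fin N => (a : ℕ) < N - 1, (1 - c * A' a)) *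
          ∏ a, A' a ^ gapExp N j a) A =
      ∑ m ∈ Finset.Ico j N,
        (-c) ^ (m - j) * skewA (fun A' => ∏ a, A' a ^ gapExp N m a) A := by
  let T : Finset (Fin N) := Finset.univ.filter fun a => (a : ℕ) < N - 1
  let seg : ℕ → Finset (Fin N) := fun m =>
    Finset.univ.filter fun a => N - 1 - m ≤ (a : ℕ) ∧ (a : ℕ) < N - 1 - j
  have hexpand : ∀ A' : Fin N → ℂ,
      (∏ a ∈ T, (1 - c * A' a)) * ∏ a, A' a ^ gapExp N j a =
        ∑ S ∈ T.powerset,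
          (-c) ^ S.card * ∏ a, A' a ^ (gapExp N j a + if a ∈ S then 1 else 0) := by
    intro A'
    simp only [sub_eq_add_neg, ← neg_mul]
    rw [Finset.prod_one_add, Finset.sum_mul]
    refine Finset.sum_congr rfl fun S _ => ?_
    simp only [pow_add, Finset.prod_mul_distrib, Finset.prod_const, pow_ite, pow_one, pow_zero,
      Finset.prod_ite_mem, Finset.univ_inter]
    ring
  have hcard : ∀ m ∈ Finset.Ico j N, (seg m).card = m - j := by
    intro m hm
    rw [Finset.mem_Ico] at hm
    have : (seg m).map Fin.valEmbedding = Finset.Ico (N - 1 - m) (N - 1 - j) := by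
      ext x
      simp only [seg, Finset.mem_map, Finset.mem_filter, Finset.mem_univ, true_and,
        Fin.valEmbedding_apply, Finset.mem_Ico]
      constructor
      · rintro ⟨a, h, rfl⟩
        exact h
      · intro h
        exact ⟨⟨x, by omega⟩, h, rfl⟩
    rw [← Finset.card_map Fin.valEmbedding, this, Nat.card_Ico]
    omega
  have hseginj : Set.InjOn seg (Finset.Ico j N : Finset ℕ) := by
    intro m hm m' hm' h
    have h1 := hcard m hm
    rw [h, hcard m' hm'] at h1
    simp only [Finset.coe_Ico, Set.mem_Ico] at hm hm'
    omega
  change skewA (fun A' => (∏ a ∈ T, (1 - c * A' a)) * ∏ a, A' a ^ gapExp N j a) A = _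
  simp only [hexpand]
  rw [skewA_sum]
  have hsub : (Finset.Ico j N).image seg ⊆ T.powerset := by
    intro S hS
    obtain ⟨m, -, rfl⟩ := Finset.mem_image.1 hS
    rw [Finset.mem_powerset]
    intro a ha
    simp only [seg, T, Finset.mem_filter, Finset.mem_univ, true_and] at ha ⊢
    omega
  rw [← Finset.sum_subset hsub, Finset.sum_image hseginj]
  · refine Finset.sum_congr rfl fun m hm => ?_
    rw [hcard m hm]
    simp only [seg, Finset.mem_filter, Finset.mem_univ, true_and,
      gapExp_add_indicator (Finset.mem_Ico.1 hm).1]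
  · intro S hS hnot
    have hninj :
        ¬ Function.Injective fun a => gapExp N j a + if a ∈ S then 1 else 0 := by
      intro hinj
      obtain ⟨m, hm, hSm⟩ := exists_eq_segment hj
        (fun a ha => (Finset.mem_filter.1 (Finset.mem_powerset.1 hS ha)).2) hinj
      exact hnot (Finset.mem_image.2 ⟨m, hm, hSm.symm⟩)
    simp only [Function.Injective, not_forall] at hninj
    obtain ⟨a, b, hab, hne⟩ := hninj
    rw [skewA_monomial_eq_zero hne hab, mul_zero]

theorem Pfun_eq_sum_range {N k M : ℕ} (hM : k < M) (ω : ℂ) (A : Fin N → ℂ) (B : ℂ) :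
    Pfun N ω k A B = ∑ j ∈ Finset.range M,
      ω ^ (-((j * (j - 1) / 2 : ℕ) : ℤ)) * qbin ω k j * B ^ (-(j : ℤ)) *
        ∏ a, A a ^ gapExp N j a := by
  refine Finset.sum_subset (Finset.range_subset_range.2 hM) fun j _ hj => ?_
  rw [qbin_eq_zero ω (by simpa using hj)]
  simp

theorem exp_neg_zpow_ne_one {N : ℕ} (hN : N ≠ 0) {i : ℕ} (hi : i + 1 < N) :
    Complex.exp (-(2 * (Real.pi : ℂ) * Complex.I) / (N : ℂ)) ^ (-((i : ℤ) + 1)) ≠ 1 := by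
  rw [neg_div, Complex.exp_neg, inv_zpow', neg_neg]
  exact_mod_cast (Complex.isPrimitiveRoot_exp N hN).pow_ne_one_of_pos_of_lt (by omega) hi

/-- Lemma `skew1`:
`Skew(P_k|_{B→ωB}) = Skew(∏_{a=1}^{N−1}(1−B⁻¹A_a) · P_{k+1})` for `0 ≤ k ≤ N−3`,
where `ω = e^{−2πi/N}`. -/
theorem statement14 (N : ℕ) (hN : 3 ≤ N) (ω : ℂ)
    (hω : ω = Complex.exp (-(2 * (Real.pi : ℂ) * Complex.I) / (N : ℂ)))
    (k : ℕ) (hk : k ≤ N - 3)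
    (A : Fin N → ℂ) (B : ℂ) (hA : ∀ a, A a ≠ 0) (hB : B ≠ 0) :
    skewA (fun A' => Pfun N ω k A' (ω * B)) A =
      skewA (fun A' =>
        (∏ a ∈ Finset.univ.filter fun a : Fin N => (a : ℕ) < N - 1, (1 - B⁻¹ * A' a)) *
          Pfun N ω (k + 1) A' B) A := by
  have hω0 : ω ≠ 0 := hω ▸ Complex.exp_ne_zero _
  have hne : ∀ i : ℕ, i + 1 < N → ω ^ (-((i : ℤ) + 1)) ≠ 1 := fun i hi =>
    hω ▸ exp_neg_zpow_ne_one (by omega) hi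
  have hL : ∀ A', Pfun N ω k A' (ω * B) = _ := fun A' =>
    Pfun_eq_sum_range (show k < N by omega) ω A' (ω * B)
  have hR : ∀ A', Pfun N ω (k + 1) A' B = _ := fun A' =>
    Pfun_eq_sum_range (show k + 1 < N by omega) ω A' B
  simp only [hL, hR, Finset.mul_sum, mul_left_comm (∏ a ∈ Finset.univ.filter _, _)]
  rw [skewA_sum, skewA_sum]
  have hterm : ∀ j ∈ Finset.range N, _ := fun j hj =>
    congrArg (ω ^ (-((j * (j - 1) / 2 : ℕ) : ℤ)) * qbin ω (k + 1) j * B ^ (-(j : ℤ)) * ·)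
      (skewA_prod_one_sub_mul_monomial (Finset.mem_range.1 hj) B⁻¹ A)
  rw [Finset.sum_congr rfl hterm]
  simp only [Finset.mul_sum]
  rw [Finset.sum_comm' (t' := Finset.range N) (s' := fun m => Finset.range (m + 1))
    (by intro j m; simp only [Finset.mem_range, Finset.mem_Ico]; omega)]
  refine Finset.sum_congr rfl fun m hm => ?_
  rw [Finset.mem_range] at hm
  have hpow : ∀ j ∈ Finset.range (m + 1), B ^ (-(j : ℤ)) * (-B⁻¹) ^ (m - j) =
      (-1) ^ m * (-1) ^ j * B ^ (-(m : ℤ)) := by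
    intro j hj
    obtain ⟨d, rfl⟩ := Nat.exists_eq_add_of_le (Nat.lt_succ_iff.1 (Finset.mem_range.1 hj))
    have hsq : ((-1 : ℂ) ^ j) * (-1) ^ j = 1 := by rw [← mul_pow]; simp
    rw [Nat.add_sub_cancel_left, neg_pow, zpow_neg, zpow_neg, zpow_natCast, zpow_natCast,
      ← inv_pow, ← inv_pow, pow_add, pow_add]
    linear_combination (-(B⁻¹ ^ j * B⁻¹ ^ d * (-1) ^ d)) * hsq
  have hsum := sum_alternating_qbin hω0 k m fun i hi => hne i (by omega)
  have hsq : ((-1 : ℂ) ^ m) * (-1) ^ m = 1 := by rw [← mul_pow]; simp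
  calc
    _ = ((-1) ^ m * ((-1) ^ m * (ω ^ (-((m * (m - 1) / 2 : ℕ) : ℤ)) * ω ^ (-(m : ℤ)) *
          qbin ω k m))) * B ^ (-(m : ℤ)) *
          skewA (fun A' => ∏ a, A' a ^ gapExp N m a) A := by
      rw [mul_zpow, ← mul_assoc ((-1 : ℂ) ^ m), hsq]
      ring
    _ = _ := by
      rw [← hsum, Finset.mul_sum, Finset.sum_mul, Finset.sum_mul]
      refine Finset.sum_congr rfl fun j hj => ?_
      linear_combination (-(ω ^ (-((j * (j - 1) / 2 : ℕ) : ℤ)) * qbin ω (k + 1) j *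
        skewA (fun A' => ∏ a, A' a ^ gapExp N m a) A)) * hpow j hj

end
end

section
/- Let N ≥ 2 be an integer and ω := e^{−2πi/N}. Let B be a nonzero complex number and c₁, c₂, c₃ complex constants satisfying c₁B^{−2}ω + c₂B^{−1}(1+ω) + c₃ = 0. Then Skew( c₁A₂A₃³ + c₂A₂²A₃³ + c₃A₁A₂²A₃³ ) = Skew( (1−B^{−1}A₁)(1−ωB^{−1}A₁)·(c₁A₂A₃³ + c₂A₂²A₃³) ), where Skew denotes the skew-symmetrization Σ_{σ∈S₃} sgn(σ)·f(A_{σ(1)},A_{σ(2)},A_{σ(3)}) with respect to A₁, A₂, A₃. -/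
open Finset

/-- Skew-symmetrization in three variables, written out over the six permutations. -/
theorem sum_sign_perm_fin_three {R α : Type*} [CommRing R] (f : α → α → α → R) (A : Fin 3 → α) :
    ∑ σ : Equiv.Perm (Fin 3), ((Equiv.Perm.sign σ : ℤ) : R) * f (A (σ 0)) (A (σ 1)) (A (σ 2)) =
      f (A 0) (A 1) (A 2) - f (A 1) (A 0) (A 2) - f (A 2) (A 1) (A 0) - f (A 0) (A 2) (A 1) +
        f (A 1) (A 2) (A 0) + f (A 2) (A 0) (A 1) := by
  have h : (univ : Finset (Equiv.Perm (Fin 3))) =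
      {1, Equiv.swap 0 1, Equiv.swap 0 2, Equiv.swap 1 2,
        Equiv.swap 0 1 * Equiv.swap 1 2, Equiv.swap 1 2 * Equiv.swap 0 1} := by decide
  rw [h]
  repeat rw [sum_insert (by decide)]
  rw [sum_singleton]
  simp [Equiv.swap_apply_def]
  ring

/-- Lemma `skew2`.  The tuple `A : Fin 3 → ℂ` is 0-indexed, so
`A 0, A 1, A 2` play the roles of `A₁, A₂, A₃`, and the skew-symmetrization
`Skew f = Σ_{σ∈S₃} sgn(σ) f(A_{σ(1)}, A_{σ(2)}, A_{σ(3)})` is written as a sum over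
`Equiv.Perm (Fin 3)`. -/
theorem statement15 (N : ℕ) (hN : 2 ≤ N) (ω : ℂ)
    (hω : ω = Complex.exp (-(2 * (Real.pi : ℂ) * Complex.I) / (N : ℂ)))
    (B : ℂ) (hB : B ≠ 0) (c₁ c₂ c₃ : ℂ)
    (hc : c₁ * B⁻¹ ^ 2 * ω + c₂ * B⁻¹ * (1 + ω) + c₃ = 0)
    (A : Fin 3 → ℂ) :
    (∑ σ : Equiv.Perm (Fin 3), ((Equiv.Perm.sign σ : ℤ) : ℂ) *
        (c₁ * A (σ 1) * A (σ 2) ^ 3 + c₂ * A (σ 1) ^ 2 * A (σ 2) ^ 3 +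
          c₃ * A (σ 0) * A (σ 1) ^ 2 * A (σ 2) ^ 3)) =
      ∑ σ : Equiv.Perm (Fin 3), ((Equiv.Perm.sign σ : ℤ) : ℂ) *
        ((1 - B⁻¹ * A (σ 0)) * (1 - ω * B⁻¹ * A (σ 0)) *
          (c₁ * A (σ 1) * A (σ 2) ^ 3 + c₂ * A (σ 1) ^ 2 * A (σ 2) ^ 3)) := by
  rw [sum_sign_perm_fin_three
      (fun x y z ↦ c₁ * y * z ^ 3 + c₂ * y ^ 2 * z ^ 3 + c₃ * x * y ^ 2 * z ^ 3),
    sum_sign_perm_fin_three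
      (fun x y z ↦ (1 - B⁻¹ * x) * (1 - ω * B⁻¹ * x) * (c₁ * y * z ^ 3 + c₂ * y ^ 2 * z ^ 3))]
  rw [eq_neg_of_add_eq_zero_right hc]
  ring
end

section
/- Let r ≥ 1 be an integer and let ℏ, x₁,…,x_{r+1}, y₁,…,y_{r−1} be complex numbers such that x₁,…,x_{r+1} are pairwise distinct and x_j ≠ y_t for all j, t. Then Σ_{s=1}^{r+1} ∏_{j≠s} [ 1/(x_j−x_s) · ∏_{t=1}^{r−1} 1/(x_j−y_t) ] · ∏_{t=1}^{r−1} (y_t−x_s−ℏ)/(y_t−x_s) = 0. -/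
open Finset

/-- A polynomial of degree less than `#s - 1` has vanishing divided difference over `s`. -/
lemma sum_eval_div_prod_sub_eq_zero {F ι : Type*} [Field F] [DecidableEq ι] {s : Finset ι}
    {v : ι → F} (hv : Set.InjOn v s) {P : Polynomial F} (hP : P.natDegree + 1 < #s) :
    ∑ i ∈ s, P.eval (v i) / ∏ j ∈ s.erase i, (v i - v j) = 0 := by
  have hdeg : P.degree < #s :=
    P.degree_le_natDegree.trans_lt (by exact_mod_cast Nat.lt_of_succ_lt hP)
  rw [← Lagrange.coeff_eq_sum hv hdeg]
  exact Polynomial.coeff_eq_zero_of_natDegree_lt (by lia)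

/-- the rational-function identity of Lemma 8.3 (`ratclaim` used for
Proposition `putD`), stated pointwise for all complex values where every denominator
occurring is nonzero.  Here `x 0, …, x r` play the role of `x₁, …, x_{r+1}` and
`y 0, …, y (r-2)` the role of `y₁, …, y_{r-1}`. -/
theorem statement17 (r : ℕ) (hr : 1 ≤ r) (ℏ : ℂ)
    (x : Fin (r + 1) → ℂ) (y : Fin (r - 1) → ℂ)
    (hx : Function.Injective x) (hxy : ∀ j t, x j ≠ y t) :
    ∑ s : Fin (r + 1),
      (∏ j ∈ Finset.univ.erase s,
          ((x j - x s)⁻¹ * ∏ t : Fin (r - 1), (x j - y t)⁻¹)) *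
        ∏ t : Fin (r - 1), (y t - x s - ℏ) / (y t - x s) = 0 := by
  set P : Polynomial ℂ := ∏ t : Fin (r - 1), (Polynomial.X - Polynomial.C (y t - ℏ)) with hP
  have hdeg : P.natDegree + 1 < #(univ : Finset (Fin (r + 1))) := by
    rw [hP, Polynomial.natDegree_finsetProd_X_sub_C_eq_card]
    simp
    lia
  have hsum := sum_eval_div_prod_sub_eq_zero hx.injOn hdeg
  set c : ℂ := (-1) ^ r * ∏ j, ∏ t : Fin (r - 1), (x j - y t)⁻¹ with hc
  rw [← mul_zero c, ← hsum, mul_sum]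
  refine sum_congr rfl fun s _ ↦ ?_
  have hsign : ∏ j ∈ univ.erase s, (x j - x s)⁻¹ =
      (-1) ^ r * (∏ j ∈ univ.erase s, (x s - x j))⁻¹ := by
    have hneg : ∀ j ∈ univ.erase s, (x j - x s)⁻¹ = -1 * (x s - x j)⁻¹ := fun j _ ↦ by
      rw [← neg_sub, inv_neg, neg_one_mul]
    rw [prod_congr rfl hneg, prod_mul_distrib, prod_const, prod_inv_distrib]
    simp
  have heval : ∏ t : Fin (r - 1), (y t - x s - ℏ) / (y t - x s) =
      (∏ t : Fin (r - 1), (x s - y t)⁻¹) * P.eval (x s) := by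
    rw [hP, Polynomial.eval_prod, ← prod_mul_distrib]
    refine prod_congr rfl fun t _ ↦ ?_
    have h₁ : x s - y t ≠ 0 := sub_ne_zero.2 (hxy s t)
    have h₂ : y t - x s ≠ 0 := sub_ne_zero.2 (hxy s t).symm
    simp only [Polynomial.eval_sub, Polynomial.eval_X, Polynomial.eval_C]
    field_simp
    ring
  rw [prod_mul_distrib, hsign, heval, hc, ← mul_prod_erase univ _ (mem_univ s)]
  ring
end

section
/- Let r ≥ 0, m ≥ 1 be integers, ℏ and x complex numbers, and let I₀, I₁, …, I_r be pairwise disjoint finite index sets each of cardinality m, with complex numbers y_j assigned to each j ∈ I₀ ∪ ⋯ ∪ I_r. Then, provided every denominator occurring is nonzero: ℏ · Σ_{s=1}^{r} ∏_{j∈I_s}(x−y_j−ℏ) · ∏_{t=s+1}^{r} ∏_{j∈I_t} (x−y_j−ℏ)/(x−y_j) · Σ_{k∈I_s} ∏_{j∈I₀}(y_k−y_j−sℏ) / [ (x−y_k−ℏ)(x−y_k) · ∏_{j∈I_s, j≠k}(y_k−y_j) ] + ∏_{j∈I₀∪⋯∪I_r}(x−y_j−ℏ) / ∏_{j∈I₁∪⋯∪I_r}(x−y_j)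 = ∏_{j∈I₀}(x−y_j−(r+1)ℏ). -/
open Finset

/-- Partial fraction expansion of the quotient of two monic polynomials of equal degree,
given by their roots, the denominator having simple roots. -/
theorem prod_sub_eq_prod_add_prod_mul_sum {F ι κ : Type*} [Field F] [DecidableEq ι]
    {S : Finset ι} {T : Finset κ} (hcard : T.card = S.card) {v : ι → F} (hv : Set.InjOn v S)
    (w : κ → F) {z : F} (hz : ∀ k ∈ S, z ≠ v k) :
    ∏ j ∈ T, (z - w j) = ∏ j ∈ S, (z - v j) + (∏ j ∈ S, (z - v j)) *
      ∑ k ∈ S, (∏ j ∈ T, (v k - w j)) / ((z - v k) * ∏ j ∈ S.erase k, (v k - v j)) := by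
  have hdeg : (Lagrange.nodal T w - Lagrange.nodal S v).degree < S.card := by
    have h := Polynomial.degree_sub_lt_left (p := Lagrange.nodal T w) (q := Lagrange.nodal S v)
      (by simp [Lagrange.degree_nodal, hcard]) (Lagrange.nodal_ne_zero)
      (by rw [Lagrange.nodal_monic.leadingCoeff, Lagrange.nodal_monic.leadingCoeff])
    rwa [Lagrange.degree_nodal, hcard] at h
  have key := congrArg (Polynomial.eval z) (Lagrange.eq_interpolate hv hdeg)
  rw [Lagrange.eval_interpolate_not_at_node _ hz, Polynomial.eval_sub, Lagrange.eval_nodal,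
    Lagrange.eval_nodal, sub_eq_iff_eq_add'] at key
  rw [key]
  congr 2
  refine sum_congr rfl fun k hk => ?_
  rw [Polynomial.eval_sub, Lagrange.eval_nodal_at_node hk, sub_zero, Lagrange.eval_nodal,
    Lagrange.nodalWeight, prod_inv_distrib, div_eq_mul_inv, mul_inv]
  ring

/-- The difference of the partial fraction expansions at `x - h` and at `x`. -/
theorem mul_prod_mul_sum_eq_prod_sub {F ι κ : Type*} [Field F] [DecidableEq ι]
    {S : Finset ι} {T : Finset κ} (hcard : T.card = S.card) {v : ι → F} (hv : Set.InjOn v S)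
    (w : κ → F) {x h : F} (hx : ∀ k ∈ S, x - v k ≠ 0 ∧ x - v k - h ≠ 0) :
    h * ((∏ j ∈ S, (x - v j - h)) * ∑ k ∈ S, (∏ j ∈ T, (v k - w j)) /
        ((x - v k - h) * (x - v k) * ∏ j ∈ S.erase k, (v k - v j))) =
      ∏ j ∈ T, (x - h - w j) -
        (∏ j ∈ T, (x - w j)) * ∏ j ∈ S, (x - v j - h) / (x - v j) := by
  have h1 := prod_sub_eq_prod_add_prod_mul_sum hcard hv w (z := x - h)
    fun k hk e => (hx k hk).2 (by rw [← e]; ring)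
  have h2 := prod_sub_eq_prod_add_prod_mul_sum hcard hv w (z := x)
    fun k hk => sub_ne_zero.1 (hx k hk).1
  have hB : ∏ j ∈ S, (x - v j) ≠ 0 := prod_ne_zero_iff.2 fun k hk => (hx k hk).1
  have hsum : h * ∑ k ∈ S, (∏ j ∈ T, (v k - w j)) /
        ((x - v k - h) * (x - v k) * ∏ j ∈ S.erase k, (v k - v j)) =
      ∑ k ∈ S, (∏ j ∈ T, (v k - w j)) / ((x - h - v k) * ∏ j ∈ S.erase k, (v k - v j)) -
      ∑ k ∈ S, (∏ j ∈ T, (v k - w j)) / ((x - v k) * ∏ j ∈ S.erase k, (v k - v j)) := by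
    rw [mul_sum, ← sum_sub_distrib]
    refine sum_congr rfl fun k hk => ?_
    obtain ⟨ha, hb⟩ := hx k hk
    have hc : ∏ j ∈ S.erase k, (v k - v j) ≠ 0 := prod_ne_zero_iff.2 fun j hj =>
      sub_ne_zero.2 fun e => (mem_erase.1 hj).1 (hv (mem_erase.1 hj).2 hk e.symm)
    rw [sub_right_comm x h (v k)]
    field_simp
    ring
  simp only [sub_right_comm x h] at h1 hsum ⊢
  rw [mul_left_comm, hsum, h1, h2, prod_div_distrib]
  field_simp
  ring

/-- The telescoped form of `mul_prod_mul_sum_eq_prod_sub`. -/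
theorem mul_sum_add_prod_eq_prod_sub {F ι κ : Type*} [Field F] [DecidableEq ι]
    (r : ℕ) (h x : F) (T : Finset κ) (w : κ → F) (I : ℕ → Finset ι) (y : ι → F)
    (hcard : ∀ s ∈ Icc 1 r, T.card = (I s).card) (hinj : ∀ s ∈ Icc 1 r, Set.InjOn y (I s))
    (hx : ∀ s ∈ Icc 1 r, ∀ k ∈ I s, x - y k ≠ 0 ∧ x - y k - h ≠ 0) :
    h * ∑ s ∈ Icc 1 r,
        (∏ j ∈ I s, (x - y j - h)) *
          (∏ t ∈ Icc (s + 1) r, ∏ j ∈ I t, (x - y j - h) / (x - y j)) *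
          ∑ k ∈ I s,
            (∏ j ∈ T, (y k - w j - (s : F) * h)) /
              ((x - y k - h) * (x - y k) * ∏ j ∈ (I s).erase k, (y k - y j))
      + (∏ j ∈ T, (x - w j - h)) * ∏ t ∈ Icc 1 r, ∏ j ∈ I t, (x - y j - h) / (x - y j)
      = ∏ j ∈ T, (x - w j - ((r : F) + 1) * h) := by
  induction r with
  | zero => simp
  | succ r ih =>
    have hsub : Icc 1 r ⊆ Icc 1 (r + 1) := Icc_subset_Icc_right r.le_succ
    have ih := ih (fun s hs => hcard s (hsub hs)) (fun s hs => hinj s (hsub hs))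
      fun s hs => hx s (hsub hs)
    have hmem : r + 1 ∈ Icc 1 (r + 1) := by simp
    have step := mul_prod_mul_sum_eq_prod_sub (hcard _ hmem) (hinj _ hmem)
      (fun j => w j + ((r + 1 : ℕ) : F) * h) (hx _ hmem)
    have hlast : ∏ j ∈ T, (x - h - (w j + ((r + 1 : ℕ) : F) * h)) =
        ∏ j ∈ T, (x - w j - (((r + 1 : ℕ) : F) + 1) * h) :=
      prod_congr rfl fun j _ => by ring
    rw [hlast] at step
    simp only [← sub_sub] at step
    rw [sum_Icc_succ_top (by lia), Icc_eq_empty (by lia : ¬ r + 1 + 1 ≤ r + 1), prod_empty,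
      mul_one, mul_add, step, prod_Icc_succ_top (by lia)]
    have hprod : ∀ s ∈ Icc 1 r,
        ∏ t ∈ Icc (s + 1) (r + 1), ∏ j ∈ I t, (x - y j - h) / (x - y j) =
        (∏ t ∈ Icc (s + 1) r, ∏ j ∈ I t, (x - y j - h) / (x - y j)) *
          ∏ j ∈ I (r + 1), (x - y j - h) / (x - y j) := fun s hs =>
      prod_Icc_succ_top (by have := mem_Icc.1 hs; lia) _
    rw [sum_congr rfl fun s hs => by rw [hprod s hs, ← mul_assoc, mul_right_comm], ← sum_mul]
    push_cast at ih ⊢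
    linear_combination (∏ j ∈ I (r + 1), (x - y j - h) / (x - y j)) * ih

/-- Lemma `ratclaim1`.  The index sets `I 0, …, I r` are pairwise disjoint
finite sets of cardinality `m`, with complex numbers `y j` attached to the indices.
The identity is stated for all complex values for which every denominator occurring
is nonzero. -/
theorem statement18 (r m : ℕ) (hm : 1 ≤ m) (ℏ x : ℂ) (I : ℕ → Finset ℕ) (y : ℕ → ℂ)
    (hcard : ∀ s ≤ r, (I s).card = m)
    (hdisj : ∀ s t, s ≤ r → t ≤ r → s ≠ t → Disjoint (I s) (I t))
    (hden1 : ∀ s, 1 ≤ s → s ≤ r → ∀ k ∈ I s, x - y k ≠ 0 ∧ x - y k - ℏ ≠ 0)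
    (hden2 : ∀ s, 1 ≤ s → s ≤ r → ∀ k ∈ I s, ∀ j ∈ I s, k ≠ j → y k - y j ≠ 0) :
    ℏ * ∑ s ∈ Icc 1 r,
        (∏ j ∈ I s, (x - y j - ℏ)) *
          (∏ t ∈ Icc (s + 1) r, ∏ j ∈ I t, (x - y j - ℏ) / (x - y j)) *
          ∑ k ∈ I s,
            (∏ j ∈ I 0, (y k - y j - (s : ℂ) * ℏ)) /
              ((x - y k - ℏ) * (x - y k) * ∏ j ∈ (I s).erase k, (y k - y j))
      + (∏ j ∈ (range (r + 1)).biUnion I, (x - y j - ℏ)) /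
          ∏ j ∈ (Icc 1 r).biUnion I, (x - y j)
      = ∏ j ∈ I 0, (x - y j - ((r : ℂ) + 1) * ℏ) := by
  have hmem {s : ℕ} (hs : s ∈ Icc 1 r) : 1 ≤ s ∧ s ≤ r := mem_Icc.1 hs
  have key := mul_sum_add_prod_eq_prod_sub r ℏ x (I 0) y I y
    (fun s hs => (hcard 0 r.zero_le).trans (hcard s (hmem hs).2).symm)
    (fun s hs k hk j hj e => by
      by_contra hkj
      exact hden2 s (hmem hs).1 (hmem hs).2 k hk j hj hkj (sub_eq_zero.2 e))
    fun s hs => hden1 s (hmem hs).1 (hmem hs).2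
  have hrange : range (r + 1) = insert 0 (Icc 1 r) := by
    ext s
    simp only [mem_range, mem_insert, mem_Icc]
    lia
  rw [← key, prod_biUnion fun s hs t ht hst => hdisj s t
      (Nat.le_of_lt_succ (mem_range.1 hs)) (Nat.le_of_lt_succ (mem_range.1 ht)) hst,
    prod_biUnion fun s hs t ht hst => hdisj s t (hmem hs).2 (hmem ht).2 hst, hrange,
    prod_insert (by simp), mul_div_assoc, ← prod_div_distrib]
  simp only [prod_div_distrib]
end

section
/- Let d ≥ 0, m ≥ 1 be integers, ℏ and x complex numbers, and let I₀, I₁, …, I_d be pairwise disjoint finite index sets each of cardinality m, with complex numbers y_j assigned to each j ∈ I₀ ∪ ⋯ ∪ I_d. Then for every a ∈ I₀, provided every denominator occurring is nonzero: Σ_{s=0}^{d} ∏_{j∈I_s}(x−y_j−(d+1−s)ℏ) · [ ∏_{j∈I_t, t<s}(y_a−y_j−ℏ) · ∏_{j∈I_t, t>s}(y_a−y_j) ] / [ (x−y_a−(d−s)ℏ)(x−y_a−(d+1−s)ℏ) ] = ∏_{j∈I₀, j≠a}(y_a−y_j−ℏ) · ∏_{j∈I_t, t>0}(y_a−y_j)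 · [1/(x−y_a)] · ∏_{j∈I₀, j≠a}(x−y_j−ℏ)/(y_a−y_j−ℏ) · ∏_{j∈I_t, t>0}(x−y_j−ℏ)/(x−y_j) + ℏ · Σ_{q=1}^{d} Σ_{k∈I_q} ∏_{j∈I_q, j≠k}(y_k−y_j−ℏ)/(y_k−y_j) · [1/(x−y_k)] · ∏_{j∈I_q, j≠k}(x−y_j−ℏ)/(y_k−y_j−ℏ) · ∏_{j∈I_t, t>q}(x−y_j−ℏ)/(x−y_j) · Σ_{s=0}^{q−1} ∏_{j∈I_s}(y_k−y_j−(q−s)ℏ) · [ ∏_{j∈I_t, t<s}(y_a−y_j−ℏ) · ∏_{j∈I_t, t>s}(y_a−y_j) ] / [ (y_k−y_a−(q−s−1)ℏ)(y_k−y_a−(q−s)ℏ) ]. -/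
open Finset

open Polynomial in
/-- Lagrange interpolation, evaluated at a point. -/
theorem eval_eq_sum_eval_mul_prod {K ι : Type*} [Field K] [DecidableEq ι] {S : Finset ι}
    {v : ι → K} (hv : Set.InjOn v S) {f : K[X]} (hf : f.degree < S.card) (z : K) :
    f.eval z = ∑ k ∈ S, f.eval (v k) * ∏ j ∈ S.erase k, (z - v j) / (v k - v j) := by
  conv_lhs => rw [Lagrange.eq_interpolate hv hf]
  simp only [Lagrange.interpolate_apply, eval_finsetSum, eval_mul, eval_C, Lagrange.basis,
    eval_prod, Lagrange.basisDivisor, eval_sub, eval_X]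
  refine sum_congr rfl fun k _ => congrArg _ (prod_congr rfl fun j _ => ?_)
  rw [div_eq_inv_mul]

open Polynomial in
/-- A polynomial `g` whose values at the shifted nodes `v k + h` are prescribed by the values of `f`
at the nodes `v k` is given by a partial-fraction type formula in terms of `f`. -/
theorem eval_eq_of_eval_shifted_nodes {K ι : Type*} [Field K] [DecidableEq ι] {S : Finset ι}
    {v : ι → K} (hv : Set.InjOn v S) {f g : K[X]} (hf : f.degree < S.card)
    (hg : g.degree < S.card) {b c h x : K}
    (hfg : ∀ k ∈ S, g.eval (v k + h) * (v k - b) = c * f.eval (v k) * (v k + h - b))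
    (hb : ∀ k ∈ S, v k - b ≠ 0) (hx : ∀ k ∈ S, x - v k ≠ 0) :
    g.eval x = c * ((∏ j ∈ S, (x - v j - h) / (x - v j)) * f.eval x +
      h * ∑ k ∈ S, (∏ j ∈ S.erase k, (x - v j - h) / (v k - v j)) *
        (f.eval (v k) * (x - b) / ((v k - b) * (x - v k)))) := by
  have hg' : (g.comp (X + C h)).degree < S.card := by
    rw [← taylor_apply, degree_taylor]
    exact hg
  have key := eval_eq_sum_eval_mul_prod hv hg' (x - h)
  simp only [eval_comp, eval_add, eval_X, eval_C, sub_add_cancel] at key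
  rw [key, eval_eq_sum_eval_mul_prod hv hf x, mul_sum, mul_sum, ← sum_add_distrib, mul_sum]
  refine sum_congr rfl fun k hk => ?_
  have h1 : (∏ j ∈ S, (x - v j - h) / (x - v j)) *
      ∏ j ∈ S.erase k, (x - v j) / (v k - v j) =
      (x - v k - h) / (x - v k) * ∏ j ∈ S.erase k, (x - v j - h) / (v k - v j) := by
    rw [← mul_prod_erase _ _ hk, mul_assoc, ← prod_mul_distrib]
    refine congrArg _ (prod_congr rfl fun j hj => ?_)
    exact div_mul_div_cancel₀ (hx j (mem_of_mem_erase hj))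
  have h2 : g.eval (v k + h) = c * f.eval (v k) * (v k + h - b) / (v k - b) :=
    eq_div_of_mul_eq (hb k hk) (hfg k hk)
  simp only [sub_right_comm x h]
  rw [h2, mul_left_comm (∏ j ∈ S, _), h1]
  have := hb k hk
  have := hx k hk
  field_simp
  ring

/-- The left-hand side of the identity. -/
noncomputable def shiftedSum (ℏ : ℂ) (I : ℕ → Finset ℕ) (y : ℕ → ℂ) (a d : ℕ) (x : ℂ) : ℂ :=
  ∑ s ∈ range (d + 1),
    (∏ j ∈ I s, (x - y j - ((d : ℂ) + 1 - s) * ℏ)) *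
      ((∏ t ∈ range s, ∏ j ∈ I t, (y a - y j - ℏ)) *
        ∏ t ∈ Icc (s + 1) d, ∏ j ∈ I t, (y a - y j)) /
      ((x - y a - ((d : ℂ) - s) * ℏ) * (x - y a - ((d : ℂ) + 1 - s) * ℏ))

theorem shiftedSum_succ (ℏ : ℂ) (I : ℕ → Finset ℕ) (y : ℕ → ℂ) (a d : ℕ) (x : ℂ) :
    shiftedSum ℏ I y a (d + 1) x =
      (∏ j ∈ I (d + 1), (y a - y j)) * shiftedSum ℏ I y a d (x - ℏ) +
        (∏ j ∈ I (d + 1), (x - y j - ℏ)) * (∏ t ∈ range (d + 1), ∏ j ∈ I t, (y a - y j - ℏ)) /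
          ((x - y a) * (x - y a - ℏ)) := by
  rw [shiftedSum, sum_range_succ, shiftedSum, mul_sum]
  congr 1
  · refine sum_congr rfl fun s hs => ?_
    rw [prod_Icc_succ_top (by have := mem_range.1 hs; omega)]
    have e1 : ∀ z : ℂ, x - z - (((d + 1 : ℕ) : ℂ) + 1 - s) * ℏ = x - ℏ - z - (d + 1 - s) * ℏ := by
      intro z; push_cast; ring
    have e2 : ∀ z : ℂ, x - z - (((d + 1 : ℕ) : ℂ) - s) * ℏ = x - ℏ - z - (d - s) * ℏ := by
      intro z; push_cast; ring
    simp only [e1, e2]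
    ring
  · simp

open Polynomial in
/-- The polynomial `(x - y a) * shiftedSum ℏ I y a d x`. -/
noncomputable def shiftedNumer (ℏ : ℂ) (I : ℕ → Finset ℕ) (y : ℕ → ℂ) (a : ℕ) : ℕ → ℂ[X]
  | 0 => ∏ j ∈ (I 0).erase a, (X - C (y j + ℏ))
  | d + 1 =>
    (C (∏ j ∈ I (d + 1), (y a - y j)) * (shiftedNumer ℏ I y a d).comp (X - C ℏ) * (X - C (y a)) +
      C (∏ t ∈ range (d + 1), ∏ j ∈ I t, (y a - y j - ℏ)) *
        ∏ j ∈ I (d + 1), (X - C (y j + ℏ))) /ₘ (X - C (y a + ℏ))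

section

variable {ℏ : ℂ} {I : ℕ → Finset ℕ} {y : ℕ → ℂ} {a : ℕ}

theorem shiftedNumer_succ_eval_of_eval_self {d : ℕ}
    (h : (shiftedNumer ℏ I y a d).eval (y a) * -ℏ =
      ∏ t ∈ range (d + 1), ∏ j ∈ I t, (y a - y j - ℏ)) (x : ℂ) :
    (shiftedNumer ℏ I y a (d + 1)).eval x * (x - y a - ℏ) =
      (∏ j ∈ I (d + 1), (y a - y j)) * (shiftedNumer ℏ I y a d).eval (x - ℏ) * (x - y a) +
        (∏ t ∈ range (d + 1), ∏ j ∈ I t, (y a - y j - ℏ)) * ∏ j ∈ I (d + 1), (x - y j - ℏ) := by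
  have hroot : Polynomial.IsRoot
      (.C (∏ j ∈ I (d + 1), (y a - y j)) * (shiftedNumer ℏ I y a d).comp (.X - .C ℏ) *
          (.X - .C (y a)) +
        .C (∏ t ∈ range (d + 1), ∏ j ∈ I t, (y a - y j - ℏ)) *
          ∏ j ∈ I (d + 1), (.X - .C (y j + ℏ))) (y a + ℏ) := by
    rw [← h]
    simp only [Polynomial.IsRoot, Polynomial.eval_add, Polynomial.eval_mul, Polynomial.eval_C,
      Polynomial.eval_comp, Polynomial.eval_sub, Polynomial.eval_X, Polynomial.eval_prod,
      add_sub_cancel_right, add_sub_add_right_eq_sub]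
    ring
  have := congrArg (Polynomial.eval x) (Polynomial.mul_divByMonic_eq_iff_isRoot.2 hroot)
  simp only [Polynomial.eval_add, Polynomial.eval_mul, Polynomial.eval_C,
    Polynomial.eval_comp, Polynomial.eval_sub, Polynomial.eval_X, Polynomial.eval_prod,
    ← sub_sub] at this
  rw [← this, mul_comm]
  rfl

theorem shiftedNumer_eval_self (ha : a ∈ I 0) (d : ℕ) :
    (shiftedNumer ℏ I y a d).eval (y a) * -ℏ =
      ∏ t ∈ range (d + 1), ∏ j ∈ I t, (y a - y j - ℏ) := by
  induction d with
  | zero =>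
    simp [shiftedNumer, Polynomial.eval_prod, ← mul_prod_erase _ _ ha, ← sub_sub, mul_comm]
  | succ d ih =>
    have := shiftedNumer_succ_eval_of_eval_self ih (y a)
    rw [prod_range_succ _ (d + 1)]
    simpa using this

theorem shiftedNumer_succ_eval (ha : a ∈ I 0) (d : ℕ) (x : ℂ) :
    (shiftedNumer ℏ I y a (d + 1)).eval x * (x - y a - ℏ) =
      (∏ j ∈ I (d + 1), (y a - y j)) * (shiftedNumer ℏ I y a d).eval (x - ℏ) * (x - y a) +
        (∏ t ∈ range (d + 1), ∏ j ∈ I t, (y a - y j - ℏ)) * ∏ j ∈ I (d + 1), (x - y j - ℏ) :=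
  shiftedNumer_succ_eval_of_eval_self (shiftedNumer_eval_self ha d) x

theorem shiftedNumer_degree_lt {m d : ℕ} (hm : 1 ≤ m) (ha : a ∈ I 0)
    (hcard : ∀ s ≤ d, (I s).card = m) : (shiftedNumer ℏ I y a d).degree < m := by
  suffices h : (shiftedNumer ℏ I y a d).natDegree < m from
    Polynomial.degree_le_natDegree.trans_lt (by exact_mod_cast h)
  induction d with
  | zero =>
    rw [shiftedNumer, Polynomial.natDegree_prod_of_monic _ _ fun j _ => Polynomial.monic_X_sub_C _]
    simp only [Polynomial.natDegree_X_sub_C, sum_const, smul_eq_mul, mul_one, card_erase_of_mem ha,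
      hcard 0 le_rfl]
    omega
  | succ d ih =>
    have ih := ih fun s hs => hcard s (by omega)
    rw [shiftedNumer, Polynomial.natDegree_divByMonic _ (Polynomial.monic_X_sub_C _),
      Polynomial.natDegree_X_sub_C]
    refine (Nat.sub_le_sub_right ?_ 1).trans_lt (Nat.sub_one_lt_of_lt hm)
    refine (Polynomial.natDegree_add_le_of_degree_le ?_ ?_)
    · refine Polynomial.natDegree_mul_le.trans ?_
      have := Polynomial.natDegree_C_mul_le (∏ j ∈ I (d + 1), (y a - y j))
        ((shiftedNumer ℏ I y a d).comp (.X - .C ℏ))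
      rw [Polynomial.natDegree_comp, Polynomial.natDegree_X_sub_C] at this
      rw [Polynomial.natDegree_X_sub_C]
      omega
    · refine (Polynomial.natDegree_C_mul_le _ _).trans ?_
      rw [Polynomial.natDegree_prod_of_monic _ _ fun j _ => Polynomial.monic_X_sub_C _]
      simp only [Polynomial.natDegree_X_sub_C, sum_const, smul_eq_mul, mul_one,
        hcard (d + 1) le_rfl, le_rfl]

theorem shiftedSum_mul_eq_eval (ha : a ∈ I 0) (d : ℕ) (x : ℂ)
    (hx : ∀ t : ℕ, t ≤ d + 1 → x - y a - (t : ℂ) * ℏ ≠ 0) :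
    shiftedSum ℏ I y a d x * (x - y a) = (shiftedNumer ℏ I y a d).eval x := by
  induction d generalizing x with
  | zero =>
    have h0 : x - y a ≠ 0 := by simpa using hx 0 (by omega)
    have h1 : x - y a - ℏ ≠ 0 := by simpa using hx 1 (by omega)
    simp only [shiftedSum, shiftedNumer, Polynomial.eval_prod]
    simp [← mul_prod_erase _ _ ha, ← sub_sub]
    field_simp
  | succ d ih =>
    have h0 : x - y a ≠ 0 := by simpa using hx 0 (by omega)
    have h1 : x - y a - ℏ ≠ 0 := by simpa using hx 1 (by omega)
    have ih := ih (x - ℏ) fun t ht => by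
      have := hx (t + 1) (by omega)
      push_cast at this
      convert this using 1
      ring
    refine mul_right_cancel₀ h1 ?_
    rw [shiftedNumer_succ_eval ha, ← ih, shiftedSum_succ]
    field_simp
    ring

/-- The inner sums of the identity are values of `shiftedSum` at the nodes. -/
theorem sum_range_eq_shiftedSum_mul_prod {d q : ℕ} (hq : q + 1 ≤ d) (z : ℂ) :
    ∑ s ∈ range (q + 1),
        (∏ j ∈ I s, (z - y j - (((q + 1 : ℕ) : ℂ) - s) * ℏ)) *
          ((∏ t ∈ range s, ∏ j ∈ I t, (y a - y j - ℏ)) *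
            ∏ t ∈ Icc (s + 1) d, ∏ j ∈ I t, (y a - y j)) /
          ((z - y a - (((q + 1 : ℕ) : ℂ) - s - 1) * ℏ) *
            (z - y a - (((q + 1 : ℕ) : ℂ) - s) * ℏ)) =
      shiftedSum ℏ I y a q z * ∏ t ∈ Icc (q + 1) d, ∏ j ∈ I t, (y a - y j) := by
  rw [shiftedSum, sum_mul]
  refine sum_congr rfl fun s hs => ?_
  have hs := mem_range.1 hs
  have e : ∏ t ∈ Icc (s + 1) d, ∏ j ∈ I t, (y a - y j) =
      (∏ t ∈ Icc (s + 1) q, ∏ j ∈ I t, (y a - y j)) *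
        ∏ t ∈ Icc (q + 1) d, ∏ j ∈ I t, (y a - y j) := by
    simp only [← Ico_add_one_right_eq_Icc]
    exact (prod_Ico_consecutive _ (by omega) (by omega)).symm
  rw [e]
  push_cast
  rw [show (q : ℂ) + 1 - s - 1 = q - s by ring]
  ring

end

/-- Lemma `ratclaim2`.  The index sets `I 0, …, I d` are pairwise disjoint
finite sets of cardinality `m`, `a ∈ I 0`, and the identity is stated for all complex
values for which every denominator occurring is nonzero. -/
theorem statement19 (d m : ℕ) (hm : 1 ≤ m) (ℏ x : ℂ) (I : ℕ → Finset ℕ) (y : ℕ → ℂ)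
    (hcard : ∀ s ≤ d, (I s).card = m)
    (hdisj : ∀ s t, s ≤ d → t ≤ d → s ≠ t → Disjoint (I s) (I t))
    (a : ℕ) (ha : a ∈ I 0)
    (hden1 : ∀ t : ℕ, t ≤ d + 1 → x - y a - (t : ℂ) * ℏ ≠ 0)
    (hden2 : ∀ q, 1 ≤ q → q ≤ d → ∀ k ∈ I q, x - y k ≠ 0)
    (hden3 : ∀ j ∈ I 0, j ≠ a → y a - y j - ℏ ≠ 0)
    (hden4 : ∀ q, 1 ≤ q → q ≤ d → ∀ k ∈ I q, ∀ j ∈ I q, k ≠ j →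
      y k - y j ≠ 0 ∧ y k - y j - ℏ ≠ 0)
    (hden5 : ∀ q, 1 ≤ q → q ≤ d → ∀ k ∈ I q, ∀ t : ℕ, t ≤ d → y k - y a - (t : ℂ) * ℏ ≠ 0) :
    ∑ s ∈ range (d + 1),
        (∏ j ∈ I s, (x - y j - ((d : ℂ) + 1 - s) * ℏ)) *
          ((∏ t ∈ range s, ∏ j ∈ I t, (y a - y j - ℏ)) *
            ∏ t ∈ Icc (s + 1) d, ∏ j ∈ I t, (y a - y j)) /
          ((x - y a - ((d : ℂ) - s) * ℏ) * (x - y a - ((d : ℂ) + 1 - s) * ℏ)) =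
      (∏ j ∈ (I 0).erase a, (y a - y j - ℏ)) * (∏ t ∈ Icc 1 d, ∏ j ∈ I t, (y a - y j)) *
          ((x - y a)⁻¹ * (∏ j ∈ (I 0).erase a, (x - y j - ℏ) / (y a - y j - ℏ)) *
            ∏ t ∈ Icc 1 d, ∏ j ∈ I t, (x - y j - ℏ) / (x - y j)) +
        ℏ * ∑ q ∈ Icc 1 d, ∑ k ∈ I q,
          (∏ j ∈ (I q).erase k, (y k - y j - ℏ) / (y k - y j)) *
            ((x - y k)⁻¹ * (∏ j ∈ (I q).erase k, (x - y j - ℏ) / (y k - y j - ℏ)) *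
              ∏ t ∈ Icc (q + 1) d, ∏ j ∈ I t, (x - y j - ℏ) / (x - y j)) *
            ∑ s ∈ range q,
              (∏ j ∈ I s, (y k - y j - ((q : ℂ) - s) * ℏ)) *
                ((∏ t ∈ range s, ∏ j ∈ I t, (y a - y j - ℏ)) *
                  ∏ t ∈ Icc (s + 1) d, ∏ j ∈ I t, (y a - y j)) /
                ((y k - y a - ((q : ℂ) - s - 1) * ℏ) * (y k - y a - ((q : ℂ) - s) * ℏ)) := by
  have hL : ∀ n x', ∑ s ∈ range (n + 1), _ = shiftedSum ℏ I y a n x' := fun _ _ => rfl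
  rw [hL d x]
  clear hL
  induction d with
  | zero =>
    have h0 : x - y a ≠ 0 := by simpa using hden1 0 (by omega)
    have h1 : ∏ j ∈ (I 0).erase a, (y a - y j - ℏ) ≠ 0 := prod_ne_zero_iff.2 fun j hj =>
      hden3 j (mem_of_mem_erase hj) (ne_of_mem_erase hj)
    have := shiftedSum_mul_eq_eval ha 0 x hden1
    rw [eq_div_of_mul_eq h0 this]
    simp [shiftedNumer, Polynomial.eval_prod, ← sub_sub, prod_div_distrib]
    field_simp
  | succ d ih =>
    have ih := ih (fun s hs => hcard s (by omega))
      (fun s t hs ht => hdisj s t (by omega) (by omega)) (fun t ht => hden1 t (by omega))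
      (fun q h1 h2 => hden2 q h1 (by omega)) (fun q h1 h2 => hden4 q h1 (by omega))
      (fun q h1 h2 k hk t ht => hden5 q h1 (by omega) k hk t (by omega))
    have h0 : x - y a ≠ 0 := by simpa using hden1 0 (by omega)
    have hb : ∀ k ∈ I (d + 1), y k - y a ≠ 0 := fun k hk => by
      simpa using hden5 (d + 1) (by omega) le_rfl k hk 0 (by omega)
    have hx : ∀ k ∈ I (d + 1), x - y k ≠ 0 := hden2 (d + 1) (by omega) le_rfl
    have hinj : Set.InjOn y (I (d + 1)) := fun k hk j hj hkj => by
      by_contra hne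
      exact (hden4 (d + 1) (by omega) le_rfl k hk j hj hne).1 (sub_eq_zero.2 hkj)
    have hc := hcard (d + 1) le_rfl
    have step := eval_eq_of_eval_shifted_nodes (f := shiftedNumer ℏ I y a d)
      (g := shiftedNumer ℏ I y a (d + 1)) (x := x) (b := y a) (h := ℏ)
      (c := ∏ j ∈ I (d + 1), (y a - y j)) hinj
      (hc.symm ▸ shiftedNumer_degree_lt (ℏ := ℏ) (y := y) hm ha
        fun s hs => hcard s (by omega))
      (hc.symm ▸ shiftedNumer_degree_lt (ℏ := ℏ) (y := y) hm ha hcard)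
      (fun k hk => by
        have := shiftedNumer_succ_eval (ℏ := ℏ) (y := y) ha d (y k + ℏ)
        rw [prod_eq_zero (f := fun j => y k + ℏ - y j - ℏ) hk (by ring),
          add_sub_cancel_right, mul_zero, add_zero] at this
        rw [← this]
        ring) hb hx
    rw [← shiftedSum_mul_eq_eval ha (d + 1) x hden1,
      ← shiftedSum_mul_eq_eval ha d x fun t ht => hden1 t (by omega)] at step
    have step' : shiftedSum ℏ I y a (d + 1) x = (∏ j ∈ I (d + 1), (y a - y j)) *
        ((∏ j ∈ I (d + 1), (x - y j - ℏ) / (x - y j)) * shiftedSum ℏ I y a d x +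
          ℏ * ∑ k ∈ I (d + 1), (∏ j ∈ (I (d + 1)).erase k, (x - y j - ℏ) / (y k - y j)) *
            ((x - y k)⁻¹ * shiftedSum ℏ I y a d (y k))) := by
      refine mul_right_cancel₀ h0 (step.trans ?_)
      rw [mul_assoc, add_mul, mul_assoc, mul_assoc, sum_mul]
      refine congrArg _ (congrArg _ (congrArg _ (sum_congr rfl fun k hk => ?_)))
      rw [← shiftedSum_mul_eq_eval ha d (y k) fun t ht =>
        hden5 (d + 1) (by omega) le_rfl k hk t ht]
      have := hb k hk
      have := hx k hk
      field_simp
    rw [step', ih, sum_Icc_succ_top (by omega), prod_Icc_succ_top (by omega),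
      prod_Icc_succ_top (by omega), mul_add, mul_add, mul_add, mul_add, ← add_assoc]
    congr 1
    · congr 1
      · ring
      · simp only [mul_sum]
        refine sum_congr rfl fun q hq => sum_congr rfl fun k _ => sum_congr rfl fun s hs => ?_
        have hq := mem_Icc.1 hq
        have hs := mem_range.1 hs
        rw [prod_Icc_succ_top (by omega), prod_Icc_succ_top (by omega)]
        ring
    · rw [mul_left_comm, mul_sum]
      refine congrArg _ (sum_congr rfl fun k hk => ?_)
      rw [sum_range_eq_shiftedSum_mul_prod le_rfl]
      have e : (∏ j ∈ (I (d + 1)).erase k, (y k - y j - ℏ) / (y k - y j)) *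
          (∏ j ∈ (I (d + 1)).erase k, (x - y j - ℏ) / (y k - y j - ℏ)) =
          ∏ j ∈ (I (d + 1)).erase k, (x - y j - ℏ) / (y k - y j) := by
        rw [← prod_mul_distrib]
        refine prod_congr rfl fun j hj => ?_
        rw [mul_comm]
        exact div_mul_div_cancel₀ (hden4 (d + 1) (by omega) le_rfl k hk j (mem_of_mem_erase hj)
          (ne_of_mem_erase hj).symm).2
      rw [← e]
      simp
      ring
end
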